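/- Let n, m be positive integers, k a weight vector, let 1 ≤ t ≤ n−1, λ ≥ 1, 0 < γ < 1, R > 1, and set T_r = R^r for r ≥ 0. Let Θ be an n×m real matrix and let (u_r)_{r≥0} be a sequence of nonzero vectors in ℤⁿ such that for every r: (i) |u_{r,i}| ≤ λ^t γ^{−m} T_r^{m k_i} for all 1 ≤ i ≤ n, and (ii) γ T_{r+1}^{−1} ≤ ψ_r ≤ γ T_r^{−1}, where ψ_r := max_{1≤j≤m} ‖Θ*_j(u_r)‖. Let x ∈ ℝⁿ and suppose inf_{r≥0} ‖u_{r,1} x_1 + ⋯ + u_{r,n} x_n‖ > 0. Then x ∈ Bad_Θ(k,n,m), i.e. inf_{q ∈ ℤ^m, q≠0} max_{1≤i≤n} |q|^{m k_i} ‖Θ_i(q) − x_i‖ > 0. -/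

import Mathlib

open Real MeasureTheory Topology

/-- Distance from a real number to the nearest integer. -/
noncomputable def distNearestInt (y : ℝ) : ℝ := ⨅ p : ℤ, |y - (p : ℝ)|

/-- `Θᵢ(q) = ∑ⱼ qⱼ Θᵢⱼ` : the `i`-th linear form of `Θ` evaluated at `q ∈ ℤᵐ`. -/
noncomputable def linForm {n m : ℕ} (Θ : Matrix (Fin n) (Fin m) ℝ) (q : Fin m → ℤ)
    (i : Fin n) : ℝ := ∑ j, (q j : ℝ) * Θ i j

/-- `Θ*ⱼ(u) = ∑ᵢ uᵢ Θᵢⱼ` : the `j`-th linear form of the transposed matrix `Θ*`. -/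
noncomputable def dualForm {n m : ℕ} (Θ : Matrix (Fin n) (Fin m) ℝ) (u : Fin n → ℤ)
    (j : Fin m) : ℝ := ∑ i, (u i : ℝ) * Θ i j

/-- The supremum norm `|q|` of an integer vector. -/
noncomputable def supNorm {m : ℕ} (q : Fin m → ℤ) : ℝ := ⨆ j, |(q j : ℝ)|

/-- A weight vector: positive entries summing to 1. -/
def IsWeight {n : ℕ} (k : Fin n → ℝ) : Prop := (∀ i, 0 < k i) ∧ ∑ i, k i = 1

/-- The set `Bad(k,n,m)` of weighted badly approximable `n × m` matrices:
`inf_{q ∈ ℤᵐ, q ≠ 0} max_{1≤i≤n} |q|^{m kᵢ} ‖Θᵢ(q)‖ > 0`. -/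
def Bad (n m : ℕ) (k : Fin n → ℝ) : Set (Matrix (Fin n) (Fin m) ℝ) :=
  {Θ | ∃ c > 0, ∀ q : Fin m → ℤ, q ≠ 0 →
    c ≤ ⨆ i, supNorm q ^ ((m : ℝ) * k i) * distNearestInt (linForm Θ q i)}

/-- The twisted set `Bad_Θ(k,n,m)`:
`{x ∈ ℝⁿ : inf_{q ∈ ℤᵐ, q ≠ 0} max_{1≤i≤n} |q|^{m kᵢ} ‖Θᵢ(q) − xᵢ‖ > 0}`. -/
def BadT (n m : ℕ) (k : Fin n → ℝ) (Θ : Matrix (Fin n) (Fin m) ℝ) : Set (Fin n → ℝ) :=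
  {x | ∃ c > 0, ∀ q : Fin m → ℤ, q ≠ 0 →
    c ≤ ⨆ i, supNorm q ^ ((m : ℝ) * k i) * distNearestInt (linForm Θ q i - x i)}

theorem distNearestInt_eq (y : ℝ) : distNearestInt y = |y - round y| := by
  have hb : BddBelow (Set.range fun p : ℤ => |y - (p : ℝ)|) :=
    ⟨0, by rintro _ ⟨p, rfl⟩; exact abs_nonneg _⟩
  exact le_antisymm (ciInf_le hb (round y)) (le_ciInf fun p => round_le y p)

theorem distNearestInt_nonneg (y : ℝ) : 0 ≤ distNearestInt y := by
  rw [distNearestInt_eq]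
  exact abs_nonneg _

theorem distNearestInt_le (y : ℝ) (p : ℤ) : distNearestInt y ≤ |y - p| := by
  rw [distNearestInt_eq]
  exact round_le y p

theorem distNearestInt_zero : distNearestInt 0 = 0 := by
  simp [distNearestInt_eq]

theorem distNearestInt_add_le (y z : ℝ) :
    distNearestInt (y + z) ≤ distNearestInt y + distNearestInt z := by
  rw [distNearestInt_eq y, distNearestInt_eq z]
  refine (distNearestInt_le _ (round y + round z)).trans ?_
  push_cast
  rw [add_sub_add_comm]
  exact abs_add_le _ _

theorem distNearestInt_neg_le (y : ℝ) : distNearestInt (-y) ≤ distNearestInt y := by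
  rw [distNearestInt_eq y]
  refine (distNearestInt_le _ (-round y)).trans_eq ?_
  push_cast
  rw [← neg_sub', abs_neg]

theorem distNearestInt_intCast_mul_le (a : ℤ) (y : ℝ) :
    distNearestInt (a * y) ≤ |(a : ℝ)| * distNearestInt y := by
  rw [distNearestInt_eq y, ← abs_mul]
  refine (distNearestInt_le _ (a * round y)).trans_eq ?_
  push_cast
  rw [mul_sub]

theorem distNearestInt_sum_le {ι : Type*} (s : Finset ι) (f : ι → ℝ) :
    distNearestInt (∑ i ∈ s, f i) ≤ ∑ i ∈ s, distNearestInt (f i) :=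
  Finset.le_sum_of_subadditive _ distNearestInt_zero.le distNearestInt_add_le s f

theorem distNearestInt_sum_intCast_mul_le {ι : Type*} (s : Finset ι) (a : ι → ℤ) (f : ι → ℝ) :
    distNearestInt (∑ i ∈ s, a i * f i) ≤ ∑ i ∈ s, |(a i : ℝ)| * distNearestInt (f i) :=
  (distNearestInt_sum_le s _).trans
    (Finset.sum_le_sum fun i _ => distNearestInt_intCast_mul_le (a i) (f i))

theorem le_supNorm {m : ℕ} (q : Fin m → ℤ) (j : Fin m) : |(q j : ℝ)| ≤ supNorm q :=
  le_ciSup (f := fun j => |(q j : ℝ)|) (Set.finite_range _).bddAbove j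

theorem one_le_supNorm {m : ℕ} {q : Fin m → ℤ} (hq : q ≠ 0) : 1 ≤ supNorm q := by
  obtain ⟨j, hj⟩ := Function.ne_iff.mp hq
  refine le_trans ?_ (le_supNorm q j)
  exact_mod_cast Int.one_le_abs hj

/-- The dual pairing identity `⟨u, Θ q⟩ = ⟨Θ* u, q⟩`. -/
theorem sum_mul_linForm {n m : ℕ} (Θ : Matrix (Fin n) (Fin m) ℝ) (u : Fin n → ℤ)
    (q : Fin m → ℤ) :
    ∑ i, (u i : ℝ) * linForm Θ q i = ∑ j, (q j : ℝ) * dualForm Θ u j := by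
  simp only [linForm, dualForm, Finset.mul_sum]
  rw [Finset.sum_comm]
  exact Finset.sum_congr rfl fun j _ => Finset.sum_congr rfl fun i _ => by ring

/-- The inhomogeneous transference inequality. -/
theorem distNearestInt_sum_mul_le {n m : ℕ} (Θ : Matrix (Fin n) (Fin m) ℝ) (u : Fin n → ℤ)
    (q : Fin m → ℤ) (x : Fin n → ℝ) :
    distNearestInt (∑ i, (u i : ℝ) * x i) ≤
      ∑ i, |(u i : ℝ)| * distNearestInt (linForm Θ q i - x i) +
        m * supNorm q * ⨆ j, distNearestInt (dualForm Θ u j) := by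
  have hsplit : ∑ i, (u i : ℝ) * x i =
      -∑ i, (u i : ℝ) * (linForm Θ q i - x i) + ∑ j, (q j : ℝ) * dualForm Θ u j := by
    rw [← sum_mul_linForm]
    simp only [mul_sub, Finset.sum_sub_distrib]
    ring
  rw [hsplit]
  refine (distNearestInt_add_le _ _).trans (add_le_add ?_ ?_)
  · exact (distNearestInt_neg_le _).trans (distNearestInt_sum_intCast_mul_le _ _ _)
  · refine (distNearestInt_sum_intCast_mul_le _ _ _).trans ?_
    have hterm : ∀ j ∈ Finset.univ, |(q j : ℝ)| * distNearestInt (dualForm Θ u j) ≤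
        supNorm q * ⨆ j, distNearestInt (dualForm Θ u j) := fun j _ =>
      mul_le_mul (le_supNorm q j)
        (le_ciSup (f := fun j => distNearestInt (dualForm Θ u j)) (Set.finite_range _).bddAbove j)
        (distNearestInt_nonneg _) ((abs_nonneg _).trans (le_supNorm q j))
    refine (Finset.sum_le_card_nsmul _ _ _ hterm).trans_eq ?_
    simp [mul_assoc]

/-- (Fact A of §4, the inhomogeneous transference argument of
§4.6.) Let `T_r = R^r` with `R > 1`, and let `(u_r)` be a sequence of nonzero
integer vectors with `|u_{r,i}| ≤ λᵗ γ^{−m} T_r^{m kᵢ}` and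
`γ T_{r+1}^{−1} ≤ ψ_r ≤ γ T_r^{−1}` where `ψ_r = max_j ‖Θ*ⱼ(u_r)‖`. If
`inf_r ‖u_{r,1}x₁ + ⋯ + u_{r,n}xₙ‖ > 0`, then `x ∈ Bad_Θ(k,n,m)`. -/
theorem factA_transference {n m : ℕ} (hn : 0 < n) (hm : 0 < m)
    (k : Fin n → ℝ) (hk : IsWeight k)
    (t : ℕ) (ht : 1 ≤ t) (htn : t ≤ n - 1)
    (lam γ R : ℝ) (hlam : 1 ≤ lam) (hγ0 : 0 < γ) (hγ1 : γ < 1) (hR : 1 < R)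
    (Θ : Matrix (Fin n) (Fin m) ℝ)
    (u : ℕ → Fin n → ℤ) (hu0 : ∀ r, u r ≠ 0)
    (hub : ∀ r : ℕ, ∀ i : Fin n,
      (|u r i| : ℝ) ≤ lam ^ t * (γ ^ m)⁻¹ * (R ^ r) ^ ((m : ℝ) * k i))
    (hψlow : ∀ r : ℕ, γ / R ^ (r + 1) ≤ ⨆ j, distNearestInt (dualForm Θ (u r) j))
    (hψhigh : ∀ r : ℕ, (⨆ j, distNearestInt (dualForm Θ (u r) j)) ≤ γ / R ^ r)
    (x : Fin n → ℝ)
    (hx : ∃ c > 0, ∀ r : ℕ, c ≤ distNearestInt (∑ i, (u r i : ℝ) * x i)) :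
    x ∈ BadT n m k Θ := by
  obtain ⟨c, hc, hcx⟩ := hx
  have hn' : (0 : ℝ) < n := by exact_mod_cast hn
  have hm' : (0 : ℝ) < m := by exact_mod_cast hm
  set C : ℝ := lam ^ t * (γ ^ m)⁻¹
  have hC : 0 < C := mul_pos (pow_pos (one_pos.trans_le hlam) t) (inv_pos.mpr (pow_pos hγ0 m))
  set B : ℝ := max 1 (2 * m * γ / c)
  have hB : 1 ≤ B := le_max_left _ _
  set A : ℝ := R * B
  have hA : 1 ≤ A := one_le_mul_of_one_le_of_one_le hR.le hB
  have hD : 0 < n * (C * A ^ (m : ℝ)) :=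
    mul_pos hn' (mul_pos hC (Real.rpow_pos_of_pos (one_pos.trans_le hA) _))
  refine ⟨c / 2 / (n * (C * A ^ (m : ℝ))), div_pos (half_pos hc) hD, fun q hq => ?_⟩
  set Q := supNorm q
  have hQ : 1 ≤ Q := one_le_supNorm hq
  have hQ0 : 0 < Q := one_pos.trans_le hQ
  set S := ⨆ i, Q ^ ((m : ℝ) * k i) * distNearestInt (linForm Θ q i - x i)
  obtain ⟨r, hr, hr'⟩ := exists_nat_pow_near (one_le_mul_of_one_le_of_one_le hB hQ) hR
  have hRr : 0 < R ^ (r + 1) := pow_pos (one_pos.trans hR) _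
  have hupper : R ^ (r + 1) ≤ A * Q := by
    rw [pow_succ', mul_assoc]
    exact mul_le_mul_of_nonneg_left hr (one_pos.trans hR).le
  have hsmall : m * Q * ⨆ j, distNearestInt (dualForm Θ (u (r + 1)) j) ≤ c / 2 := by
    refine (mul_le_mul_of_nonneg_left (hψhigh (r + 1)) (mul_pos hm' hQ0).le).trans ?_
    rw [← mul_div_assoc, div_le_iff₀ hRr]
    have h1 : 2 * m * γ ≤ B * c := (div_le_iff₀ hc).mp (le_max_right _ _)
    nlinarith [mul_le_mul_of_nonneg_right h1 hQ0.le, mul_lt_mul_of_pos_left hr' hc]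
  have hterm : ∀ i ∈ Finset.univ,
      |(u (r + 1) i : ℝ)| * distNearestInt (linForm Θ q i - x i) ≤ C * A ^ (m : ℝ) * S := by
    intro i _
    have hki : k i ≤ 1 := hk.2 ▸
      Finset.single_le_sum (fun j _ => (hk.1 j).le) (Finset.mem_univ i)
    have hu : |(u (r + 1) i : ℝ)| ≤ C * A ^ (m : ℝ) * Q ^ ((m : ℝ) * k i) := by
      refine (hub (r + 1) i).trans ?_
      rw [mul_assoc C]
      refine mul_le_mul_of_nonneg_left ?_ hC.le
      refine (Real.rpow_le_rpow hRr.le hupper (mul_pos hm' (hk.1 i)).le).trans ?_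
      rw [Real.mul_rpow (one_pos.trans_le hA).le hQ0.le]
      exact mul_le_mul_of_nonneg_right
        (Real.rpow_le_rpow_of_exponent_le hA (mul_le_of_le_one_right hm'.le hki))
        (Real.rpow_nonneg hQ0.le _)
    refine (mul_le_mul_of_nonneg_right hu (distNearestInt_nonneg _)).trans ?_
    rw [mul_assoc]
    exact mul_le_mul_of_nonneg_left
      (le_ciSup (f := fun i => Q ^ ((m : ℝ) * k i) * distNearestInt (linForm Θ q i - x i))
        (Set.finite_range _).bddAbove i)
      (mul_pos hC (Real.rpow_pos_of_pos (one_pos.trans_le hA) _)).le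
  have hsum := Finset.sum_le_card_nsmul _ _ _ hterm
  rw [Finset.card_univ, Fintype.card_fin, nsmul_eq_mul] at hsum
  rw [div_le_iff₀ hD]
  linarith [hcx (r + 1), distNearestInt_sum_mul_le Θ (u (r + 1)) q x]
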